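/- arXiv:2602.16028 — 2 statements merged into one kernel-verified Lean document; each statement's English description precedes it below -/
import Mathlib

section
/- Let M = (Ω, P) be a canonical partially observable Markov chain with |Ω| = n ≥ 3 and sink s, and let a, b ∈ Ω be states with Q := AQC_M(a,b) finite and Q ≥ 1. Then there exist an integer 0 ≤ k ≤ n−2 and partitions 𝒫₀, 𝒫₁, …, 𝒫_k of Ω such that: 𝒫₀ = {Ω∖{s}, {s}}; for each 1 ≤ i ≤ k, 𝒫_i refines 𝒫_{i−1}, separates at least one pair of states lying in a common class of 𝒫_{i−1}, and w(𝒫_{i−1}, 𝒫_i) ≤ (3(n−1)·Q)²; and 𝒫_k(a) ≠ 𝒫_k(b). In particular, the product Π_{i=1}^{k} w(𝒫_{i−1}, 𝒫_i) is at most (3(n−1)·Q)^{2(n−2)}. -/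
open Finset
open scoped ENNReal

/-- A canonical partially observable Markov chain: a finite state space with a
distinguished absorbing sink state; `P x y` is the probability of moving from `x` to `y`. -/
structure Canonical (Ω : Type) [Fintype Ω] [DecidableEq Ω] where
  P : Ω → Ω → ℝ
  sink : Ω
  nonneg : ∀ x y, 0 ≤ P x y
  sum_one : ∀ x, ∑ y, P x y = 1
  sink_absorb : P sink sink = 1

variable {Ω : Type} [Fintype Ω] [DecidableEq Ω]

/-- Observation: `true` iff the state is the sink. -/
def Canonical.obs (M : Canonical Ω) (x : Ω) : Bool := decide (x = M.sink)

/-- The observation history `Z₀, …, Z_t` of a state trajectory `g`. -/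
def obsHist (M : Canonical Ω) (g : ℕ → Ω) (t : ℕ) : List Bool :=
  (List.range (t + 1)).map fun i => M.obs (g i)

/-- Probability of the state trajectory `g` (conditionally on its initial state `g 0`)
under rewinding strategy `A`, for `T` steps: at each time `t`, the next state `g (t+1)` is
drawn from the state at time `t - A(Z₀,…,Z_t)` (truncated subtraction realizes `max 0 _`). -/
noncomputable def trajProb (M : Canonical Ω) (A : List Bool → ℕ) (T : ℕ) (g : ℕ → Ω) : ℝ :=
  ∏ t ∈ Finset.range T, M.P (g (t - A (obsHist M g t))) (g (t + 1))

/-- Extend `f : Fin (T+1) → Ω` to `ℕ → Ω` by clamping. -/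
def extendTraj {Ω : Type} (T : ℕ) (f : Fin (T + 1) → Ω) : ℕ → Ω :=
  fun n => f ⟨min n T, Nat.lt_succ_of_le (min_le_right n T)⟩

/-- The probability that the chain `M` with rewinding strategy `A`, started at `x`,
produces the observation sequence `z = (Z₀, …, Z_T)`.  This is the distribution `D_T^{A,x}`. -/
noncomputable def obsSeqProb (M : Canonical Ω) (A : List Bool → ℕ) (x : Ω) (T : ℕ)
    (z : Fin (T + 1) → Bool) : ℝ :=
  ∑ f : Fin (T + 1) → Ω,
    if f 0 = x ∧ (∀ i, M.obs (f i) = z i) then trajProb M A T (extendTraj T f) else 0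

/-- Total variation distance between the observation-sequence distributions
`D_T^{A,a}` and `D_T^{A,b}`. -/
noncomputable def obsTV (M : Canonical Ω) (A : List Bool → ℕ) (a b : Ω) (T : ℕ) : ℝ :=
  (1 / 2) * ∑ z : Fin (T + 1) → Bool, |obsSeqProb M A a T z - obsSeqProb M A b T z|

/-- A rewinding strategy is non-adaptive if it depends only on the length of the history. -/
def NonAdaptive (A : List Bool → ℕ) : Prop :=
  ∀ l₁ l₂ : List Bool, l₁.length = l₂.length → A l₁ = A l₂

/-- Query complexity `QC^A_M(a,b)`: the least `T` with `d_TV(D_T^{A,a}, D_T^{A,b}) ≥ 1/3`,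
as an element of `ℝ≥0∞` (`⊤` if no such `T` exists). -/
noncomputable def QC (M : Canonical Ω) (A : List Bool → ℕ) (a b : Ω) : ℝ≥0∞ :=
  sInf {x : ℝ≥0∞ | ∃ T : ℕ, x = (T : ℝ≥0∞) ∧ 1 / 3 ≤ obsTV M A a b T}

/-- Adaptive query complexity: infimum over all rewinding strategies. -/
noncomputable def AQC (M : Canonical Ω) (a b : Ω) : ℝ≥0∞ :=
  ⨅ A : List Bool → ℕ, QC M A a b

/-- Non-adaptive query complexity: infimum over all non-adaptive rewinding strategies. -/
noncomputable def NAQC (M : Canonical Ω) (a b : Ω) : ℝ≥0∞ :=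
  ⨅ A : {A : List Bool → ℕ // NonAdaptive A}, QC M A.1 a b
/-- A partition of a finite type `Ω`, given by the map sending each element to its class. -/
structure Partn (Ω : Type) [Fintype Ω] [DecidableEq Ω] where
  cls : Ω → Finset Ω
  mem_cls : ∀ x, x ∈ cls x
  cls_eq : ∀ x y, y ∈ cls x → cls y = cls x

/-- `probOf P x C = P(C|x)`, the probability that the next state after `x` lies in `C`. -/
noncomputable def probOf {Ω : Type} [Fintype Ω] (P : Ω → Ω → ℝ) (x : Ω) (C : Finset Ω) : ℝ :=
  ∑ y ∈ C, P x y

/-- Projected total variation distance `d_TV^Pt(a,b)`. -/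
noncomputable def dTVP {Ω : Type} [Fintype Ω] [DecidableEq Ω] (P : Ω → Ω → ℝ)
    (Pt : Partn Ω) (a b : Ω) : ℝ :=
  (1 / 2) * ∑ C ∈ Finset.univ.image Pt.cls, |probOf P a C - probOf P b C|

/-- `Pt'` refines `Pt` if every class of `Pt'` is contained in a class of `Pt`. -/
def Refines {Ω : Type} [Fintype Ω] [DecidableEq Ω] (Pt' Pt : Partn Ω) : Prop :=
  ∀ x, Pt'.cls x ⊆ Pt.cls x

/-- The weight `w(Pt,Pt')`: the maximum of `1/d_TV^Pt(x,y)²` over pairs `x, y` lying in the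
same class of `Pt` but different classes of `Pt'` (valued in `ℝ≥0∞`; `1/0 = ⊤`). -/
noncomputable def wgt {Ω : Type} [Fintype Ω] [DecidableEq Ω] (P : Ω → Ω → ℝ)
    (Pt Pt' : Partn Ω) : ℝ≥0∞ :=
  ⨆ (x : Ω) (y : Ω) (_ : Pt.cls x = Pt.cls y ∧ Pt'.cls x ≠ Pt'.cls y),
    (ENNReal.ofReal ((dTVP P Pt x y) ^ 2))⁻¹

section ProjectedDistance

variable (M : Canonical Ω) (Pt : Partn Ω)

theorem Partn.cls_eq_iff {x y : Ω} : Pt.cls x = Pt.cls y ↔ y ∈ Pt.cls x :=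
  ⟨fun h => h ▸ Pt.mem_cls y, fun h => (Pt.cls_eq x y h).symm⟩

theorem Partn.filter_cls_eq (x : Ω) :
    (univ.filter fun y => Pt.cls y = Pt.cls x) = Pt.cls x := by
  ext y
  rw [mem_filter, eq_comm, Pt.cls_eq_iff]
  simp

theorem dTVP_self (P : Ω → Ω → ℝ) (x : Ω) : dTVP P Pt x x = 0 := by
  simp [dTVP]

theorem dTVP_comm (P : Ω → Ω → ℝ) (x y : Ω) : dTVP P Pt x y = dTVP P Pt y x := by
  simp only [dTVP, abs_sub_comm]

theorem dTVP_triangle (P : Ω → Ω → ℝ) (x y z : Ω) :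
    dTVP P Pt x z ≤ dTVP P Pt x y + dTVP P Pt y z := by
  simp only [dTVP]
  rw [← mul_add, ← sum_add_distrib]
  gcongr
  exact abs_sub_le _ _ _

/-- A `[0,1]`-valued function that is constant on classes has expectations under `P(·|x)` and
`P(·|y)` that differ by at most the projected total variation distance. -/
theorem expect_sub_le_dTVP (φ : Ω → ℝ) (h0 : ∀ y, 0 ≤ φ y) (h1 : ∀ y, φ y ≤ 1)
    (hφ : ∀ y y', Pt.cls y = Pt.cls y' → φ y = φ y') (x w : Ω) :
    ∑ y, M.P x y * φ y - ∑ y, M.P w y * φ y ≤ dTVP M.P Pt x w := by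
  have hcenter : ∑ y, M.P x y * φ y - ∑ y, M.P w y * φ y
      = ∑ y, (M.P x y - M.P w y) * (φ y - 1 / 2) := by
    have : ∑ y, (M.P x y - M.P w y) * (φ y - 1 / 2)
        = ∑ y, M.P x y * φ y - ∑ y, M.P w y * φ y
          - (1 / 2) * (∑ y, M.P x y - ∑ y, M.P w y) := by
      rw [← sum_sub_distrib, ← sum_sub_distrib, mul_sum, ← sum_sub_distrib]
      exact sum_congr rfl fun y _ => by ring
    rw [this, M.sum_one, M.sum_one]
    ring
  rw [hcenter, dTVP, mul_sum,
    ← sum_fiberwise_of_maps_to (g := Pt.cls) (t := univ.image Pt.cls)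
      fun y _ => mem_image_of_mem _ (mem_univ y)]
  refine sum_le_sum fun C hC => ?_
  obtain ⟨c, -, rfl⟩ := mem_image.mp hC
  rw [Pt.filter_cls_eq]
  have hconst : ∑ y ∈ Pt.cls c, (M.P x y - M.P w y) * (φ y - 1 / 2)
      = (probOf M.P x (Pt.cls c) - probOf M.P w (Pt.cls c)) * (φ c - 1 / 2) := by
    rw [probOf, probOf, ← sum_sub_distrib, sum_mul]
    refine sum_congr rfl fun y hy => ?_
    rw [hφ y c (Pt.cls_eq c y hy)]
  rw [hconst]
  refine (le_abs_self _).trans ?_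
  rw [abs_mul, mul_comm]
  gcongr
  rw [abs_le]
  constructor <;> linarith [h0 c, h1 c]

end ProjectedDistance

section Trajectories

variable (M : Canonical Ω) (A : List Bool → ℕ)

theorem obsHist_congr {g g' : ℕ → Ω} {t : ℕ} (h : ∀ i ≤ t, M.obs (g i) = M.obs (g' i)) :
    obsHist M g t = obsHist M g' t :=
  List.map_congr_left fun i hi => h i (Nat.lt_succ_iff.mp (List.mem_range.mp hi))

theorem trajProb_congr {g g' : ℕ → Ω} {T : ℕ} (h : ∀ i ≤ T, g i = g' i) :
    trajProb M A T g = trajProb M A T g' := by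
  refine prod_congr rfl fun t ht => ?_
  have ht := mem_range.mp ht
  rw [obsHist_congr M (g := g) (g' := g') fun i hi => by rw [h i (by omega)],
    h (t + 1) (by omega), h _ (by omega)]

theorem trajProb_nonneg (T : ℕ) (g : ℕ → Ω) : 0 ≤ trajProb M A T g :=
  prod_nonneg fun _ _ => M.nonneg _ _

theorem extendTraj_snoc_of_le {Ω : Type} {T : ℕ} (f : Fin (T + 1) → Ω) (y : Ω) {i : ℕ} (hi : i ≤ T) :
    extendTraj (T + 1) (Fin.snoc f y : Fin (T + 2) → Ω) i = extendTraj T f i := by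
  simp only [extendTraj]
  have h : (⟨min i (T + 1), Nat.lt_succ_of_le (min_le_right i (T + 1))⟩ : Fin (T + 2))
      = Fin.castSucc ⟨min i T, Nat.lt_succ_of_le (min_le_right i T)⟩ := by
    ext
    simp
    omega
  rw [h, Fin.snoc_castSucc (α := fun _ => Ω)]

theorem extendTraj_snoc_last {Ω : Type} {T : ℕ} (f : Fin (T + 1) → Ω) (y : Ω) :
    extendTraj (T + 1) (Fin.snoc f y : Fin (T + 2) → Ω) (T + 1) = y := by
  simp only [extendTraj]
  have h : (⟨min (T + 1) (T + 1), Nat.lt_succ_of_le (min_le_right (T + 1) (T + 1))⟩ : Fin (T + 2))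
      = Fin.last (T + 1) := by
    ext
    simp
  rw [h, Fin.snoc_last (α := fun _ => Ω)]

/-- The state from which step `T` is sampled, after the trajectory `f` up to time `T`. -/
def sampledFrom (T : ℕ) (f : Fin (T + 1) → Ω) : Ω :=
  extendTraj T f (T - A (obsHist M (extendTraj T f) T))

theorem trajProb_snoc {T : ℕ} (f : Fin (T + 1) → Ω) (y : Ω) :
    trajProb M A (T + 1) (extendTraj (T + 1) (Fin.snoc f y : Fin (T + 2) → Ω))
      = trajProb M A T (extendTraj T f) * M.P (sampledFrom M A T f) y := by
  have hle {i : ℕ} (hi : i ≤ T) := extendTraj_snoc_of_le f y hi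
  rw [← trajProb_congr M A fun i hi => hle hi, trajProb, prod_range_succ, ← trajProb,
    extendTraj_snoc_last, hle (Nat.sub_le _ _), obsHist_congr M fun i hi => by rw [hle hi]]
  rfl

/-- The expectation of `h` over trajectories of length `T` started at `x`. -/
noncomputable def trajExpect (x : Ω) (T : ℕ) (h : (Fin (T + 1) → Ω) → ℝ) : ℝ :=
  ∑ f : Fin (T + 1) → Ω, if f 0 = x then trajProb M A T (extendTraj T f) * h f else 0

theorem trajExpect_mono (x : Ω) (T : ℕ) {h h' : (Fin (T + 1) → Ω) → ℝ} (hh : ∀ f, h f ≤ h' f) :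
    trajExpect M A x T h ≤ trajExpect M A x T h' := by
  refine sum_le_sum fun f _ => ?_
  split_ifs
  · exact mul_le_mul_of_nonneg_left (hh f) (trajProb_nonneg M A T _)
  · exact le_rfl

theorem trajExpect_add (x : Ω) (T : ℕ) (h h' : (Fin (T + 1) → Ω) → ℝ) :
    trajExpect M A x T (fun f => h f + h' f)
      = trajExpect M A x T h + trajExpect M A x T h' := by
  simp only [trajExpect, ← sum_add_distrib]
  refine sum_congr rfl fun f _ => ?_
  split_ifs <;> ring

theorem trajExpect_const_mul (x : Ω) (T : ℕ) (c : ℝ) (h : (Fin (T + 1) → Ω) → ℝ) :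
    trajExpect M A x T (fun f => c * h f) = c * trajExpect M A x T h := by
  simp only [trajExpect, mul_sum]
  refine sum_congr rfl fun f _ => ?_
  split_ifs <;> ring

theorem trajExpect_sum {ι : Type*} (s : Finset ι) (x : Ω) (T : ℕ)
    (h : ι → (Fin (T + 1) → Ω) → ℝ) :
    trajExpect M A x T (fun f => ∑ i ∈ s, h i f) = ∑ i ∈ s, trajExpect M A x T (h i) := by
  simp only [trajExpect]
  rw [sum_comm]
  refine sum_congr rfl fun f _ => ?_
  split_ifs
  · rw [mul_sum]
  · simp

theorem trajExpect_zero (x : Ω) (h : (Fin 1 → Ω) → ℝ) :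
    trajExpect M A x 0 h = h fun _ => x := by
  rw [trajExpect, Fintype.sum_eq_single fun _ => x]
  · simp [trajProb]
  · intro f hf
    refine if_neg fun h0 => hf ?_
    funext i
    rw [Fin.fin_one_eq_zero i]
    exact h0

theorem trajExpect_succ (x : Ω) (T : ℕ) (h : (Fin (T + 2) → Ω) → ℝ) :
    trajExpect M A x (T + 1) h
      = trajExpect M A x T fun f =>
          ∑ y, M.P (sampledFrom M A T f) y * h (Fin.snoc f y : Fin (T + 2) → Ω) := by
  simp only [trajExpect]
  rw [← Equiv.sum_comp (Fin.snocEquiv fun _ => Ω), Fintype.sum_prod_type_right]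
  refine sum_congr rfl fun f _ => ?_
  have h0 (y : Ω) : (Fin.snoc f y : Fin (T + 2) → Ω) 0 = f 0 :=
    Fin.snoc_castSucc (α := fun _ => Ω) y f 0
  have hs (y : Ω) : Fin.snocEquiv (fun _ : Fin (T + 2) => Ω) (y, f) = Fin.snoc f y := rfl
  simp only [hs, h0, trajProb_snoc]
  split_ifs
  · rw [mul_sum]
    exact sum_congr rfl fun y _ => by ring
  · simp

theorem trajExpect_one (x : Ω) (T : ℕ) : trajExpect M A x T (fun _ => 1) = 1 := by
  induction T with
  | zero => exact trajExpect_zero M A x _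
  | succ T ih =>
    rw [trajExpect_succ]
    simpa only [mul_one, M.sum_one] using ih

variable (Pt : Partn Ω)

theorem sampledFrom_cls (hobs : ∀ x y, Pt.cls x = Pt.cls y → M.obs x = M.obs y) {T : ℕ}
    {f f' : Fin (T + 1) → Ω} (hf : ∀ i, Pt.cls (f i) = Pt.cls (f' i)) :
    Pt.cls (sampledFrom M A T f) = Pt.cls (sampledFrom M A T f') := by
  have hhist : obsHist M (extendTraj T f) T = obsHist M (extendTraj T f') T :=
    obsHist_congr M fun i _ => hobs _ _ (hf _)
  rw [sampledFrom, sampledFrom, hhist]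
  exact hf _

theorem cls_snoc {T : ℕ} {f f' : Fin (T + 1) → Ω} (hf : ∀ i, Pt.cls (f i) = Pt.cls (f' i))
    {y y' : Ω} (hy : Pt.cls y = Pt.cls y') (i : Fin (T + 2)) :
    Pt.cls ((Fin.snoc f y : Fin (T + 2) → Ω) i)
      = Pt.cls ((Fin.snoc f' y' : Fin (T + 2) → Ω) i) := by
  induction i using Fin.lastCases with
  | last => simpa using hy
  | cast i => simpa using hf i

/-- If states in a common class have nearby projected transition distributions, then the class
trajectories started from two states of a common class are hard to distinguish. -/
theorem trajExpect_sub_le (hobs : ∀ x y, Pt.cls x = Pt.cls y → M.obs x = M.obs y) {δ : ℝ}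
    (hδ : ∀ x y, Pt.cls x = Pt.cls y → dTVP M.P Pt x y ≤ δ) {a b : Ω}
    (hab : Pt.cls a = Pt.cls b) (T : ℕ) (h : (Fin (T + 1) → Ω) → ℝ)
    (h0 : ∀ f, 0 ≤ h f) (h1 : ∀ f, h f ≤ 1)
    (hinv : ∀ f f', (∀ i, Pt.cls (f i) = Pt.cls (f' i)) → h f = h f') :
    trajExpect M A a T h - trajExpect M A b T h ≤ T * δ := by
  induction T with
  | zero =>
    rw [trajExpect_zero, trajExpect_zero, hinv _ (fun _ => b) fun _ => hab]
    simp
  | succ T ih =>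
    let g (w : Ω) (f : Fin (T + 1) → Ω) : ℝ := ∑ y, M.P w y * h (Fin.snoc f y : Fin (T + 2) → Ω)
    let h' (f : Fin (T + 1) → Ω) : ℝ :=
      (Pt.cls (sampledFrom M A T f)).inf' ⟨_, Pt.mem_cls _⟩ fun w => g w f
    have hle (f) : h' f ≤ g (sampledFrom M A T f) f := inf'_le _ (Pt.mem_cls _)
    have hge (f) : g (sampledFrom M A T f) f ≤ h' f + δ := by
      obtain ⟨w, hw, hw'⟩ := exists_mem_eq_inf' ⟨_, Pt.mem_cls (sampledFrom M A T f)⟩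
        fun w => g w f
      have hd := expect_sub_le_dTVP M Pt (fun y => h (Fin.snoc f y : Fin (T + 2) → Ω))
        (fun _ => h0 _) (fun _ => h1 _)
        (fun y y' hy => hinv _ _ (cls_snoc Pt (fun _ => rfl) hy)) (sampledFrom M A T f) w
      have := hδ _ w (Pt.cls_eq_iff.mpr hw)
      simp only [h', hw']
      simp only [g]
      linarith
    have hb : trajExpect M A b T h' ≤ trajExpect M A b (T + 1) h := by
      rw [trajExpect_succ]
      exact trajExpect_mono M A b T hle
    have ha : trajExpect M A a (T + 1) h ≤ trajExpect M A a T h' + δ := by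
      rw [trajExpect_succ]
      refine (trajExpect_mono M A a T hge).trans_eq ?_
      have hconst : trajExpect M A a T (fun _ => δ) = δ := by
        simpa [trajExpect_one] using trajExpect_const_mul M A a T δ fun _ => 1
      rw [trajExpect_add, hconst]
    have hg0 (w f) : 0 ≤ g w f := sum_nonneg fun y _ => mul_nonneg (M.nonneg _ _) (h0 _)
    have hg1 (w f) : g w f ≤ 1 := by
      rw [← M.sum_one w]
      exact sum_le_sum fun y _ => mul_le_of_le_one_right (M.nonneg _ _) (h1 _)
    have := ih h' (fun f => le_inf' _ _ fun w _ => hg0 w f) (fun f => (hle f).trans (hg1 _ f))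
      (fun f f' hf => by
        refine inf'_congr _ (sampledFrom_cls M A Pt hobs hf) fun w _ => ?_
        refine sum_congr rfl fun y _ => ?_
        rw [hinv _ _ (cls_snoc Pt hf rfl)])
    push_cast
    linarith

theorem sum_mul_obsSeqProb (x : Ω) (T : ℕ) (c : (Fin (T + 1) → Bool) → ℝ) :
    ∑ z, c z * obsSeqProb M A x T z = trajExpect M A x T fun f => c fun i => M.obs (f i) := by
  simp only [obsSeqProb, trajExpect, mul_sum]
  rw [sum_comm]
  refine sum_congr rfl fun f _ => ?_
  rw [Fintype.sum_eq_single fun i => M.obs (f i)]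
  · simp only [implies_true, and_true]
    split_ifs <;> ring
  · intro z hz
    rw [if_neg, mul_zero]
    exact fun h => hz (funext fun i => (h.2 i).symm)

theorem obsTV_le (hobs : ∀ x y, Pt.cls x = Pt.cls y → M.obs x = M.obs y) {δ : ℝ}
    (hδ : ∀ x y, Pt.cls x = Pt.cls y → dTVP M.P Pt x y ≤ δ) {a b : Ω}
    (hab : Pt.cls a = Pt.cls b) (T : ℕ) : obsTV M A a b T ≤ T * δ := by
  let p := obsSeqProb M A a T
  let q := obsSeqProb M A b T
  have key (S : (Fin (T + 1) → Bool) → Prop) [DecidablePred S] (a b : Ω)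
      (hab : Pt.cls a = Pt.cls b) :
      ∑ z, (if S z then 1 else 0) * obsSeqProb M A a T z
        - ∑ z, (if S z then 1 else 0) * obsSeqProb M A b T z ≤ T * δ := by
    rw [sum_mul_obsSeqProb M A a T, sum_mul_obsSeqProb M A b T]
    refine trajExpect_sub_le M A Pt hobs hδ hab T _ ?_ ?_ ?_
    · intro f
      split_ifs <;> norm_num
    · intro f
      split_ifs <;> norm_num
    · intro f f' hf
      have : (fun i => M.obs (f i)) = fun i => M.obs (f' i) := funext fun i => hobs _ _ (hf i)
      simp only [this]
  classical
  have hpos := key (fun z => q z ≤ p z) a b hab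
  have hneg := key (fun z => ¬ q z ≤ p z) b a hab.symm
  have habs : ∑ z, |p z - q z|
      = (∑ z, (if q z ≤ p z then 1 else 0) * p z - ∑ z, (if q z ≤ p z then 1 else 0) * q z)
        + (∑ z, (if ¬ q z ≤ p z then 1 else 0) * q z
          - ∑ z, (if ¬ q z ≤ p z then 1 else 0) * p z) := by
    rw [← sum_sub_distrib, ← sum_sub_distrib, ← sum_add_distrib]
    refine sum_congr rfl fun z _ => ?_
    by_cases hz : q z ≤ p z
    · rw [abs_of_nonneg (sub_nonneg.mpr hz)]
      simp [hz]
    · rw [abs_of_neg (by linarith)]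
      simp [hz]
  change 1 / 2 * ∑ z, |p z - q z| ≤ _
  rw [habs]
  linarith

end Trajectories

section Refinement

/-- The partition into the sink and the remaining states. -/
def sinkPartn (M : Canonical Ω) : Partn Ω where
  cls x := if x = M.sink then {M.sink} else univ.erase M.sink
  mem_cls x := by
    by_cases h : x = M.sink <;> simp [h]
  cls_eq x y := by
    by_cases h : x = M.sink
    · simp only [h, if_true, mem_singleton]
      rintro rfl
      simp
    · simp only [h, if_false, mem_erase]
      exact fun hy => if_neg hy.1

theorem obs_eq_of_sinkPartn_cls_eq (M : Canonical Ω) {x y : Ω}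
    (h : (sinkPartn M).cls x = (sinkPartn M).cls y) : M.obs x = M.obs y := by
  have hy := (sinkPartn M).cls_eq_iff.mp h
  by_cases hx : x = M.sink <;> simp_all [sinkPartn, Canonical.obs]

theorem Refines.cls_eq {Pt' Pt : Partn Ω} (h : Refines Pt' Pt) {x y : Ω}
    (hxy : Pt'.cls x = Pt'.cls y) : Pt.cls x = Pt.cls y :=
  Pt.cls_eq_iff.mpr (h x (Pt'.cls_eq_iff.mp hxy))

theorem Refines.card_lt {Pt' Pt : Partn Ω} (h : Refines Pt' Pt) {x y : Ω}
    (hxy : Pt.cls x = Pt.cls y) (hxy' : Pt'.cls x ≠ Pt'.cls y) :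
    (univ.image Pt.cls).card < (univ.image Pt'.cls).card := by
  let F : Finset Ω → Finset Ω := fun C => C.biUnion Pt.cls
  have hF (z : Ω) : F (Pt'.cls z) = Pt.cls z := by
    ext w
    simp only [F, mem_biUnion]
    constructor
    · rintro ⟨v, hv, hw⟩
      rwa [← Pt.cls_eq z v (h z hv)]
    · exact fun hw => ⟨z, Pt'.mem_cls z, hw⟩
  have himg : univ.image Pt.cls = (univ.image Pt'.cls).image F := by
    rw [image_image]
    exact image_congr fun z _ => (hF z).symm
  rw [himg]
  refine lt_of_le_of_ne card_image_le fun hcard => hxy' ?_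
  refine card_image_iff.mp hcard ?_ ?_ (by rw [hF, hF, hxy])
  · exact mem_coe.mpr (mem_image_of_mem _ (mem_univ x))
  · exact mem_coe.mpr (mem_image_of_mem _ (mem_univ y))

/-- The graph joining states of a common class at projected distance less than `ε`. -/
def closeGraph (P : Ω → Ω → ℝ) (ε : ℝ) (Pt : Partn Ω) : SimpleGraph Ω where
  Adj x y := x ≠ y ∧ Pt.cls x = Pt.cls y ∧ dTVP P Pt x y < ε
  symm := ⟨fun x y h => ⟨h.1.symm, h.2.1.symm, by rw [dTVP_comm]; exact h.2.2⟩⟩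
  loopless := ⟨fun _ h => h.1 rfl⟩

open Classical in
/-- The partition into connected components of `closeGraph`. -/
noncomputable def refineClose (P : Ω → Ω → ℝ) (ε : ℝ) (Pt : Partn Ω) : Partn Ω where
  cls x := univ.filter fun y => (closeGraph P ε Pt).Reachable x y
  mem_cls x := by simp
  cls_eq x y hy := by
    have hy : (closeGraph P ε Pt).Reachable x y := by simpa using hy
    ext z
    simp only [mem_filter, mem_univ, true_and]
    exact ⟨hy.trans, hy.symm.trans⟩

variable (P : Ω → Ω → ℝ) (ε : ℝ) (Pt : Partn Ω)

theorem refineClose_cls_eq_iff {x y : Ω} :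
    (refineClose P ε Pt).cls x = (refineClose P ε Pt).cls y
      ↔ (closeGraph P ε Pt).Reachable x y := by
  rw [Partn.cls_eq_iff]
  simp [refineClose]

theorem refineClose_refines : Refines (refineClose P ε Pt) Pt := by
  intro x y hy
  replace hy : (closeGraph P ε Pt).Reachable x y := by simpa [refineClose] using hy
  rw [← Pt.cls_eq_iff]
  obtain ⟨w⟩ := hy
  induction w with
  | nil => rfl
  | cons hadj _ ih => exact hadj.2.1.trans ih

theorem dTVP_le_of_walk {x y : Ω} (w : (closeGraph P ε Pt).Walk x y) :
    dTVP P Pt x y ≤ w.length * ε ∧ (0 < w.length → dTVP P Pt x y < w.length * ε) := by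
  induction w with
  | nil => simp [dTVP_self]
  | cons hadj w ih =>
    rename_i u v t
    have := dTVP_triangle Pt P u v t
    have hlt : dTVP P Pt u t < (w.length + 1) * ε := by linarith [hadj.2.2, ih.1]
    simp only [SimpleGraph.Walk.length_cons, Nat.cast_add, Nat.cast_one]
    exact ⟨hlt.le, fun _ => hlt⟩

theorem dTVP_lt_of_refineClose_cls_eq (hε : 0 < ε) (hΩ : 2 ≤ Fintype.card Ω) {x y : Ω}
    (h : (refineClose P ε Pt).cls x = (refineClose P ε Pt).cls y) :
    dTVP P Pt x y < ((Fintype.card Ω : ℝ) - 1) * ε := by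
  obtain ⟨w, hw⟩ := ((refineClose_cls_eq_iff P ε Pt).mp h).exists_isPath
  have hcard : (2 : ℝ) ≤ Fintype.card Ω := by exact_mod_cast hΩ
  have hlen : (w.length : ℝ) + 1 ≤ Fintype.card Ω := by exact_mod_cast hw.length_lt
  rcases Nat.eq_zero_or_pos w.length with h0 | hpos
  · have := (dTVP_le_of_walk P ε Pt w).1
    rw [h0, Nat.cast_zero, zero_mul] at this
    exact this.trans_lt (mul_pos (by linarith) hε)
  · refine ((dTVP_le_of_walk P ε Pt w).2 hpos).trans_le ?_
    exact mul_le_mul_of_nonneg_right (by linarith) hε.le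

theorem wgt_refineClose_le {B : ℝ} (hB : 0 < B) :
    wgt P Pt (refineClose P B⁻¹ Pt) ≤ ENNReal.ofReal (B ^ 2) := by
  refine iSup_le fun x => iSup_le fun y => iSup_le fun ⟨hxy, hxy'⟩ => ?_
  have hd : B⁻¹ ≤ dTVP P Pt x y := by
    by_contra! hlt
    refine hxy' ((refineClose_cls_eq_iff P B⁻¹ Pt).mpr (SimpleGraph.Adj.reachable ⟨?_, hxy, hlt⟩))
    rintro rfl
    exact hxy' rfl
  have hB2 : ENNReal.ofReal (B ^ 2) = (ENNReal.ofReal (B⁻¹ ^ 2))⁻¹ := by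
    rw [← ENNReal.ofReal_inv_of_pos (by positivity), inv_pow, inv_inv]
  rw [hB2]
  gcongr

end Refinement

/-- Iterating `refineClose` stabilizes after at most `card Ω - 2` steps. -/
theorem exists_refineClose_stable (M : Canonical Ω) (hΩ : 2 ≤ Fintype.card Ω) (ε : ℝ) :
    ∃ k ≤ Fintype.card Ω - 2,
      (∀ x y, ((refineClose M.P ε)^[k] (sinkPartn M)).cls x
          = ((refineClose M.P ε)^[k] (sinkPartn M)).cls y →
        ((refineClose M.P ε)^[k + 1] (sinkPartn M)).cls x
          = ((refineClose M.P ε)^[k + 1] (sinkPartn M)).cls y) ∧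
      ∀ i < k, ∃ x y, ((refineClose M.P ε)^[i] (sinkPartn M)).cls x
          = ((refineClose M.P ε)^[i] (sinkPartn M)).cls y ∧
        ((refineClose M.P ε)^[i + 1] (sinkPartn M)).cls x
          ≠ ((refineClose M.P ε)^[i + 1] (sinkPartn M)).cls y := by
  set Ps : ℕ → Partn Ω := fun i => (refineClose M.P ε)^[i] (sinkPartn M) with hPs
  have href (i : ℕ) : Refines (Ps (i + 1)) (Ps i) := by
    simp only [hPs, Function.iterate_succ_apply']
    exact refineClose_refines _ _ _
  have hgrow (j : ℕ) (hj : ∀ i < j, ∃ x y, (Ps i).cls x = (Ps i).cls y ∧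
      (Ps (i + 1)).cls x ≠ (Ps (i + 1)).cls y) : j + 2 ≤ (univ.image (Ps j).cls).card := by
    induction j with
    | zero =>
      have : Nontrivial Ω := Fintype.one_lt_card_iff_nontrivial.mp hΩ
      obtain ⟨x, hx⟩ := exists_ne M.sink
      refine one_lt_card.mpr ⟨_, mem_image_of_mem _ (mem_univ x), _,
        mem_image_of_mem _ (mem_univ M.sink), fun h => ?_⟩
      simpa [Canonical.obs, hx] using obs_eq_of_sinkPartn_cls_eq M h
    | succ j ih =>
      obtain ⟨x, y, hxy, hxy'⟩ := hj j (Nat.lt_succ_self j)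
      have := (href j).card_lt hxy hxy'
      have := ih fun i hi => hj i (by omega)
      omega
  have hcard (j : ℕ) : (univ.image (Ps j).cls).card ≤ Fintype.card Ω := card_image_le
  classical
  have hex : ∃ k, ∀ x y, (Ps k).cls x = (Ps k).cls y →
      (Ps (k + 1)).cls x = (Ps (k + 1)).cls y := by
    by_contra! hno
    have := hgrow (Fintype.card Ω) fun i _ => hno i
    have := hcard (Fintype.card Ω)
    omega
  have hmin : ∀ i < Nat.find hex, ∃ x y, (Ps i).cls x = (Ps i).cls y ∧
      (Ps (i + 1)).cls x ≠ (Ps (i + 1)).cls y := by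
    intro i hi
    simpa only [not_forall, exists_prop] using Nat.find_min hex hi
  refine ⟨Nat.find hex, ?_, Nat.find_spec hex, hmin⟩
  have := hgrow _ hmin
  have := hcard (Nat.find hex)
  omega

/-- If the projected distance is uniformly small on the classes of a partition compatible with
observations, then states of a common class have large adaptive query complexity. -/
theorem lt_AQC (M : Canonical Ω) (Pt : Partn Ω)
    (hobs : ∀ x y, Pt.cls x = Pt.cls y → M.obs x = M.obs y) {Q : ℕ} (hQ : 1 ≤ Q)
    (hδ : ∀ x y, Pt.cls x = Pt.cls y → dTVP M.P Pt x y < 1 / (3 * Q)) {a b : Ω}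
    (hab : Pt.cls a = Pt.cls b) : (Q : ℝ≥0∞) < AQC M a b := by
  obtain ⟨m, hm, hmax⟩ := exists_max_image
    (univ.filter fun p : Ω × Ω => Pt.cls p.1 = Pt.cls p.2) (fun p => dTVP M.P Pt p.1 p.2)
    ⟨(a, b), by simpa using hab⟩
  have hQ0 : (0 : ℝ) < Q := by exact_mod_cast hQ
  have hm0 : 0 ≤ dTVP M.P Pt m.1 m.2 := by
    have := hmax (a, a) (by simp)
    rwa [dTVP_self] at this
  have hmδ := hδ m.1 m.2 (by simpa using hm)
  rw [lt_div_iff₀ (by positivity)] at hmδ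
  have hlow : ((Q + 1 : ℕ) : ℝ≥0∞) ≤ AQC M a b := by
    refine le_iInf fun A => le_sInf ?_
    rintro _ ⟨T, rfl, hT⟩
    rw [Nat.cast_le]
    by_contra! hTQ
    have htv := obsTV_le M A Pt hobs (fun x y h => hmax (x, y) (by simpa using h)) hab T
    have hTQ' : (T : ℝ) ≤ Q := by exact_mod_cast Nat.lt_succ_iff.mp hTQ
    have := mul_le_mul_of_nonneg_right hTQ' hm0
    linarith
  exact lt_of_lt_of_le (by exact_mod_cast Nat.lt_succ_self Q) hlow

theorem stmt_8 {Ω : Type} [Fintype Ω] [DecidableEq Ω] (M : Canonical Ω)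
    (n : ℕ) (hn : 3 ≤ n) (hcard : Fintype.card Ω = n)
    (a b : Ω) (Q : ℕ) (hQ : 1 ≤ Q) (hAQC : AQC M a b = (Q : ℝ≥0∞)) :
    ∃ k : ℕ, k ≤ n - 2 ∧
      ∃ Ps : ℕ → Partn Ω,
        (Ps 0).cls =
            (fun x => if x = M.sink then {M.sink} else Finset.univ.erase M.sink) ∧
        (∀ i : ℕ, i < k →
          Refines (Ps (i + 1)) (Ps i) ∧
          (∃ x y : Ω, (Ps i).cls x = (Ps i).cls y ∧ (Ps (i + 1)).cls x ≠ (Ps (i + 1)).cls y) ∧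
          wgt M.P (Ps i) (Ps (i + 1)) ≤ ENNReal.ofReal ((3 * ((n : ℝ) - 1) * Q) ^ 2)) ∧
        (Ps k).cls a ≠ (Ps k).cls b ∧
        ∏ i ∈ Finset.range k, wgt M.P (Ps i) (Ps (i + 1)) ≤
          ENNReal.ofReal ((3 * ((n : ℝ) - 1) * Q) ^ (2 * (n - 2))) := by
  subst hcard
  set B : ℝ := 3 * ((Fintype.card Ω : ℝ) - 1) * Q with hB
  have hn' : (3 : ℝ) ≤ Fintype.card Ω := by exact_mod_cast hn
  have hQ' : (1 : ℝ) ≤ Q := by exact_mod_cast hQ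
  have hB1 : 1 ≤ B := by nlinarith
  have hB0 : 0 < B := by linarith
  obtain ⟨k, hk, hstable, hsep⟩ := exists_refineClose_stable M (by omega) B⁻¹
  set Ps : ℕ → Partn Ω := fun i => (refineClose M.P B⁻¹)^[i] (sinkPartn M) with hPs
  have hsucc (i : ℕ) : Ps (i + 1) = refineClose M.P B⁻¹ (Ps i) :=
    Function.iterate_succ_apply' _ _ _
  have href (i : ℕ) : Refines (Ps (i + 1)) (Ps i) := hsucc i ▸ refineClose_refines _ _ _
  have hwgt (i : ℕ) : wgt M.P (Ps i) (Ps (i + 1)) ≤ ENNReal.ofReal (B ^ 2) :=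
    hsucc i ▸ wgt_refineClose_le M.P (Ps i) hB0
  have hobs (i : ℕ) : ∀ x y, (Ps i).cls x = (Ps i).cls y → M.obs x = M.obs y := by
    induction i with
    | zero => exact fun x y => obs_eq_of_sinkPartn_cls_eq M
    | succ i ih => exact fun x y h => ih x y ((href i).cls_eq h)
  refine ⟨k, hk, Ps, rfl, fun i hi => ⟨href i, hsep i hi, hwgt i⟩, fun hab => ?_, ?_⟩
  · refine (lt_AQC M (Ps k) (hobs k) hQ (fun x y h => ?_) hab).ne' hAQC
    have hd := dTVP_lt_of_refineClose_cls_eq M.P B⁻¹ (Ps k) (inv_pos.mpr hB0) (by omega)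
      (x := x) (y := y) (by rw [← hsucc]; exact hstable x y h)
    refine hd.trans_eq ?_
    have : (Fintype.card Ω : ℝ) - 1 ≠ 0 := by linarith
    rw [hB]
    field_simp
  · calc ∏ i ∈ Finset.range k, wgt M.P (Ps i) (Ps (i + 1))
        ≤ ∏ _i ∈ Finset.range k, ENNReal.ofReal (B ^ 2) := prod_le_prod' fun i _ => hwgt i
      _ = ENNReal.ofReal (B ^ (2 * k)) := by
        rw [prod_const, card_range, ← ENNReal.ofReal_pow (by positivity), pow_mul]
      _ ≤ ENNReal.ofReal (B ^ (2 * (Fintype.card Ω - 2))) := by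
        gcongr
end

section
/- In the chain M₀, passive observation cannot distinguish a from a': for the passive rewinding strategy A ≡ 0 and every T ∈ ℕ, the distributions D_T^{A,a} and D_T^{A,a'} of the observation sequences are identical. Equivalently, the hitting time τ of the sink s for the (ordinary) Markov chain satisfies, for every integer t ≥ 2, Pr[τ = t | X₀ = a] = Pr[τ = t | X₀ = a'] = 2^{−(t−1)}, and both probabilities vanish for t ≤ 1. -/
open Finset
open scoped ENNReal

variable {Ω : Type} [Fintype Ω] [DecidableEq Ω]

/-- Transition probabilities of the chain `M₀` on states `a = 0`, `b = 1`, `a' = 2`,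
`b' = 3`, `s = 4`: `P(a|a) = P(b|a) = 1/2`, `P(s|b) = 1`, `P(b'|a') = 1`,
`P(b'|b') = P(s|b') = 1/2`, `P(s|s) = 1`. -/
noncomputable def M0P : Fin 5 → Fin 5 → ℝ := fun i j =>
  if i = 0 then (if j = 0 then 1 / 2 else if j = 1 then 1 / 2 else 0)
  else if i = 1 then (if j = 4 then 1 else 0)
  else if i = 2 then (if j = 3 then 1 else 0)
  else if i = 3 then (if j = 3 then 1 / 2 else if j = 4 then 1 / 2 else 0)
  else (if j = 4 then 1 else 0)

/-- Probability that the ordinary (passive) Markov chain started at `x` first hits the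
sink at time `t`. -/
noncomputable def hitProb (M : Canonical Ω) (x : Ω) (t : ℕ) : ℝ :=
  ∑ f : Fin (t + 1) → Ω,
    if f 0 = x ∧ f (Fin.last t) = M.sink ∧ (∀ i, i ≠ Fin.last t → f i ≠ M.sink) then
      ∏ i : Fin t, M.P (f i.castSucc) (f i.succ)
    else 0

/-- Probability that the passive chain `M` started at `x` follows, for `T` steps, a trajectory
satisfying `Q`. -/
noncomputable def passiveProb (M : Canonical Ω) (x : Ω) (T : ℕ)
    (Q : (Fin (T + 1) → Ω) → Prop) [DecidablePred Q] : ℝ :=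
  ∑ f : Fin (T + 1) → Ω,
    if f 0 = x ∧ Q f then ∏ i : Fin T, M.P (f i.castSucc) (f i.succ) else 0

lemma trajProb_passive (M : Canonical Ω) (T : ℕ) (f : Fin (T + 1) → Ω) :
    trajProb M (fun _ => 0) T (extendTraj T f) =
      ∏ i : Fin T, M.P (f i.castSucc) (f i.succ) := by
  rw [trajProb, Finset.prod_range]
  refine Finset.prod_congr rfl fun i _ => ?_
  simp only [extendTraj, Nat.sub_zero]
  congr 2
  · ext; simp [i.isLt.le]
  · ext; simp [Nat.succ_le_of_lt i.isLt]

lemma obsSeqProb_passive (M : Canonical Ω) (x : Ω) (T : ℕ) (z : Fin (T + 1) → Bool) :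
    obsSeqProb M (fun _ => 0) x T z = passiveProb M x T fun f => ∀ i, M.obs (f i) = z i := by
  simp only [obsSeqProb, passiveProb, trajProb_passive]

/-- First-step decomposition of the passive chain. -/
lemma passiveProb_succ (M : Canonical Ω) (x : Ω) (T : ℕ)
    (Q : (Fin (T + 2) → Ω) → Prop) [DecidablePred Q] :
    passiveProb M x (T + 1) Q =
      ∑ y, M.P x y * passiveProb M y T fun g => Q (Fin.cons x g : Fin (T + 2) → Ω) := by
  simp only [passiveProb, Finset.mul_sum]
  rw [Finset.sum_comm, ← (Fin.consEquiv fun _ => Ω).sum_comp, Fintype.sum_prod_type,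
    Finset.sum_comm]
  refine Finset.sum_congr rfl fun g _ => ?_
  rw [Finset.sum_eq_single x (fun y _ hy => by simp [Fin.consEquiv, hy]) (by simp),
    Finset.sum_eq_single (g 0) (fun y _ hy => by simp [hy.symm]) (by simp)]
  simp [Fin.consEquiv, Fin.prod_univ_succ]

lemma passiveProb_false (M : Canonical Ω) (x : Ω) (T : ℕ)
    (Q : (Fin (T + 1) → Ω) → Prop) [DecidablePred Q] (hQ : ∀ f, f 0 = x → ¬ Q f) :
    passiveProb M x T Q = 0 :=
  Finset.sum_eq_zero fun f _ => if_neg fun h => hQ f h.1 h.2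

lemma passiveProb_zero (M : Canonical Ω) (x : Ω)
    (Q : (Fin 1 → Ω) → Prop) [DecidablePred Q] :
    passiveProb M x 0 Q = if Q fun _ => x then 1 else 0 := by
  rw [passiveProb, Finset.sum_eq_single fun _ => x]
  · simp
  · intro f _ hf
    refine if_neg fun h => hf (funext fun i => ?_)
    rw [Fin.fin_one_eq_zero i, h.1]
  · simp

lemma obsSeqProb_passive_zero (M : Canonical Ω) (x : Ω) (z : Fin 1 → Bool) :
    obsSeqProb M (fun _ => 0) x 0 z = if M.obs x = z 0 then 1 else 0 := by
  simp [obsSeqProb_passive, passiveProb_zero]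

lemma obsSeqProb_passive_succ (M : Canonical Ω) (x : Ω) (T : ℕ) (z : Fin (T + 2) → Bool) :
    obsSeqProb M (fun _ => 0) x (T + 1) z =
      if M.obs x = z 0 then
        ∑ y, M.P x y * obsSeqProb M (fun _ => 0) y T (Fin.tail z) else 0 := by
  simp only [obsSeqProb_passive]
  split_ifs with h
  · simp [passiveProb_succ, Fin.forall_fin_succ (n := T + 1), h, Fin.tail]
    congr!
  · exact passiveProb_false M x _ _ fun f hf hQ => h (hf ▸ hQ 0)

lemma hitProb_eq_passiveProb (M : Canonical Ω) (x : Ω) (t : ℕ) :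
    hitProb M x t = passiveProb M x t fun f =>
      f (Fin.last t) = M.sink ∧ ∀ i, i ≠ Fin.last t → f i ≠ M.sink := rfl

lemma hitProb_zero (M : Canonical Ω) (x : Ω) :
    hitProb M x 0 = if x = M.sink then 1 else 0 := by
  rw [hitProb_eq_passiveProb, passiveProb_zero]
  simp

lemma hitProb_succ (M : Canonical Ω) (x : Ω) (t : ℕ) :
    hitProb M x (t + 1) = if x = M.sink then 0 else ∑ y, M.P x y * hitProb M y t := by
  simp only [hitProb_eq_passiveProb]
  split_ifs with h
  · exact passiveProb_false M x _ _ fun f hf hQ =>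
      hQ.2 0 (Fin.last_pos).ne (hf.trans h)
  · simp [passiveProb_succ, Fin.forall_fin_succ (n := t + 1), h, ← Fin.succ_last]

lemma sum_M0P_zero (h : Fin 5 → ℝ) : ∑ y, M0P 0 y * h y = 1 / 2 * h 0 + 1 / 2 * h 1 := by
  simp [M0P, Fin.sum_univ_five]

lemma sum_M0P_one (h : Fin 5 → ℝ) : ∑ y, M0P 1 y * h y = h 4 := by
  simp [M0P]

lemma sum_M0P_two (h : Fin 5 → ℝ) : ∑ y, M0P 2 y * h y = h 3 := by
  simp [M0P]

lemma sum_M0P_three (h : Fin 5 → ℝ) : ∑ y, M0P 3 y * h y = 1 / 2 * h 3 + 1 / 2 * h 4 := by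
  simp [M0P, Fin.sum_univ_five]

/-- Under passive observation, `b'` is indistinguishable from the uniform mixture of
`a` and `b`, the state of the chain one step after `a`. -/
lemma obsSeqProb_mix (M : Canonical (Fin 5)) (hP : M.P = M0P) (hs : M.sink = 4) (T : ℕ) :
    ∀ z : Fin (T + 1) → Bool,
      obsSeqProb M (fun _ => 0) 3 T z =
        1 / 2 * obsSeqProb M (fun _ => 0) 0 T z + 1 / 2 * obsSeqProb M (fun _ => 0) 1 T z := by
  induction T with
  | zero =>
    intro z
    cases h : z 0 <;> simp [obsSeqProb_passive_zero, Canonical.obs, hs, h]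
    norm_num
  | succ T ih =>
    intro z
    have := ih (Fin.tail z)
    cases h : z 0 <;>
      simp [obsSeqProb_passive_succ, Canonical.obs, hs, hP, h, sum_M0P_zero, sum_M0P_one,
        sum_M0P_three]
    linarith

lemma hitProb_mix (M : Canonical (Fin 5)) (hP : M.P = M0P) (hs : M.sink = 4) (t : ℕ) :
    hitProb M 3 t = 1 / 2 * hitProb M 0 t + 1 / 2 * hitProb M 1 t := by
  induction t with
  | zero => simp [hitProb_zero, hs]
  | succ t ih =>
    simp [hitProb_succ, hs, hP, sum_M0P_zero, sum_M0P_one, sum_M0P_three]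
    linarith

lemma hitProb_geometric (M : Canonical (Fin 5)) (hP : M.P = M0P) (hs : M.sink = 4) (t : ℕ) :
    hitProb M 3 (t + 1) = (1 / 2 : ℝ) ^ (t + 1) := by
  induction t with
  | zero =>
    rw [hitProb_succ, hP, sum_M0P_three]
    simp [hitProb_zero, hs]
  | succ t ih =>
    have h4 : hitProb M 4 (t + 1) = 0 := by simp [hitProb_succ, hs]
    rw [hitProb_succ]
    simp [ih, h4, hs, hP, sum_M0P_three]
    ring

theorem stmt_16 (M : Canonical (Fin 5)) (hP : M.P = M0P) (hs : M.sink = 4) :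
    (∀ (T : ℕ) (z : Fin (T + 1) → Bool),
        obsSeqProb M (fun _ => 0) 0 T z = obsSeqProb M (fun _ => 0) 2 T z) ∧
    (∀ t : ℕ, 2 ≤ t →
        hitProb M 0 t = (1 / 2 : ℝ) ^ (t - 1) ∧ hitProb M 2 t = (1 / 2 : ℝ) ^ (t - 1)) ∧
    (∀ t : ℕ, t ≤ 1 → hitProb M 0 t = 0 ∧ hitProb M 2 t = 0) := by
  have h0 (t : ℕ) : hitProb M 0 (t + 1) = hitProb M 3 t := by
    rw [hitProb_mix M hP hs, hitProb_succ]
    simp [hs, hP, sum_M0P_zero]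
  have h2 (t : ℕ) : hitProb M 2 (t + 1) = hitProb M 3 t := by
    rw [hitProb_succ]
    simp [hs, hP, sum_M0P_two]
  refine ⟨fun T z => ?_, fun t ht => ?_, fun t ht => ?_⟩
  · cases T with
    | zero => simp [obsSeqProb_passive_zero, Canonical.obs, hs]
    | succ T =>
      have := obsSeqProb_mix M hP hs T (Fin.tail z)
      simp [obsSeqProb_passive_succ, Canonical.obs, hs, hP, sum_M0P_zero, sum_M0P_two, this]
  · obtain ⟨t, rfl⟩ := Nat.exists_eq_add_of_le' ht
    rw [h0, h2, hitProb_geometric M hP hs]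
    exact ⟨rfl, rfl⟩
  · interval_cases t
    · simp [hitProb_zero, hs]
    · simp [h0 0, h2 0, hitProb_zero, hs]
end
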